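/- Suppose f ∈ L²(ℝ) is phase-space localized with tolerance δ₁. Then for every integer m ≥ 0, ‖f⁻ₘ − (Pₘ Pₘ₋₁ ⋯ P₁ P₀) f‖_{L²} ≤ δ₁·((3m² + 15m)/2 + 6 + 75·kmax)·‖f‖_{L²}. -/

import Mathlib

open MeasureTheory Real Complex Set Function
open scoped ENNReal

noncomputable section

/-- The error function `erf x = (2/√π) ∫₀ˣ e^{-t²} dt`. -/
def erf' (x : ℝ) : ℝ := (2 / Real.sqrt Real.pi) * ∫ t in (0:ℝ)..x, Real.exp (-t^2)

/-- The complementary error function `erfc x = 1 - erf x`. -/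
def erfc' (x : ℝ) : ℝ := 1 - erf' x

/-- The inverse of the strictly decreasing bijection `erfc' : [0,∞) → (0,1]`. -/
def erfcInv (y : ℝ) : ℝ := Function.invFunOn erfc' (Set.Ici 0) y

/-- The spatial cutoff χ₀(x) = (1/2)[erf((x+3L/4)/σ) − erf((x−3L/4)/σ)]. -/
def chi0 (L σ x : ℝ) : ℝ := (1/2) * (erf' ((x + 3*L/4)/σ) - erf' ((x - 3*L/4)/σ))

/-- The frequency cutoff P₀(k) = (1/2)[erf(σ(k+3kmax/8)) − erf(σ(k−3kmax/8))]. -/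
def P0fun (kmax σ k : ℝ) : ℝ := (1/2) * (erf' (σ*(k + 3*kmax/8)) - erf' (σ*(k - 3*kmax/8)))

/-- The scaled spatial cutoff χₘ(x) = χ₀(2^{-m} x). -/
def chiSc (L σ : ℝ) (m : ℕ) (x : ℝ) : ℝ := chi0 L σ (x / 2^m)

/-- The scaled frequency cutoff Pₘ(k) = P₀(2^m k). -/
def PSc (kmax σ : ℝ) (m : ℕ) (k : ℝ) : ℝ := P0fun kmax σ (2^m * k)

/-- Fourier transform with the convention f̂(k) = (2π)^{-1/2} ∫ f(x) e^{-ikx} dx. -/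
def ft (f : ℝ → ℂ) (k : ℝ) : ℂ :=
  (Real.sqrt (2*Real.pi) : ℂ)⁻¹ * ∫ x : ℝ, Complex.exp (-(Complex.I * k * x)) * f x

/-- Inverse Fourier transform with the convention (2π)^{-1/2} ∫ g(k) e^{ikx} dk. -/
def ift (g : ℝ → ℂ) (x : ℝ) : ℂ :=
  (Real.sqrt (2*Real.pi) : ℂ)⁻¹ * ∫ k : ℝ, Complex.exp (Complex.I * k * x) * g k

/-- The space L²(ℝ, ℂ). -/
abbrev L2 := Lp ℂ 2 (volume : Measure ℝ)

/-- `T` is the bounded Fourier multiplier operator on L² with symbol `m`: on the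
dense set of `f ∈ L¹ ∩ L²` with integrable Fourier transform, `T f = 𝓕⁻¹(m·𝓕f)`.
(This uniquely determines `T` for a bounded symbol.) -/
def IsMultOp (m : ℝ → ℝ) (T : L2 →L[ℂ] L2) : Prop :=
  ∀ f : L2, Integrable (f : ℝ → ℂ) volume → Integrable (ft (f : ℝ → ℂ)) volume →
    (T f : ℝ → ℂ) =ᵐ[volume] ift (fun k => (m k : ℂ) * ft (f : ℝ → ℂ) k)

/-- `T` is the operator of pointwise multiplication by the real function `c`. -/
def IsMulBy (c : ℝ → ℝ) (T : L2 →L[ℂ] L2) : Prop :=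
  ∀ f : L2, (T f : ℝ → ℂ) =ᵐ[volume] fun x => (c x : ℂ) * f x

lemma hasDerivAt_erf' (x : ℝ) :
    HasDerivAt erf' (2 / Real.sqrt Real.pi * Real.exp (-x ^ 2)) x := by
  have hc : Continuous fun t : ℝ => Real.exp (-t ^ 2) := by fun_prop
  exact (intervalIntegral.integral_hasDerivAt_right (hc.intervalIntegrable _ _)
    (hc.stronglyMeasurableAtFilter _ _) hc.continuousAt).const_mul _

lemma continuous_erf' : Continuous erf' :=
  continuous_iff_continuousAt.2 fun x => (hasDerivAt_erf' x).continuousAt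

lemma monotone_erf' : Monotone erf' :=
  monotone_of_hasDerivAt_nonneg hasDerivAt_erf' fun x => by positivity

lemma erf'_neg (x : ℝ) : erf' (-x) = -erf' x := by
  have h := intervalIntegral.integral_comp_neg (a := 0) (b := x) fun t : ℝ => Real.exp (-t ^ 2)
  simp only [neg_sq, neg_zero] at h
  rw [erf', erf', intervalIntegral.integral_symm, ← h]
  ring

lemma tendsto_erf'_atTop : Filter.Tendsto erf' Filter.atTop (nhds 1) := by
  have hi : IntegrableOn (fun t : ℝ => Real.exp (-t ^ 2)) (Ioi 0) := by
    simpa using (integrable_exp_neg_mul_sq one_pos).integrableOn (s := Ioi 0)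
  have h := (intervalIntegral_tendsto_integral_Ioi 0 hi Filter.tendsto_id).const_mul
    (2 / Real.sqrt Real.pi)
  have hv : ∫ t in Ioi (0 : ℝ), Real.exp (-t ^ 2) = Real.sqrt Real.pi / 2 := by
    simpa using integral_gaussian_Ioi 1
  have hpi : Real.sqrt Real.pi ≠ 0 := (Real.sqrt_pos.2 Real.pi_pos).ne'
  rw [hv, show 2 / Real.sqrt Real.pi * (Real.sqrt Real.pi / 2) = 1 by field_simp] at h
  exact h

lemma erf'_le_one (x : ℝ) : erf' x ≤ 1 :=
  monotone_erf'.ge_of_tendsto tendsto_erf'_atTop x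

lemma neg_one_le_erf' (x : ℝ) : -1 ≤ erf' x := by
  have := erf'_le_one (-x)
  rw [erf'_neg] at this
  linarith

lemma erfcInv_nonneg_and_erfc'_erfcInv {y : ℝ} (hy : 0 < y) (hy' : y ≤ erfc' 1) :
    0 ≤ erfcInv y ∧ erfc' (erfcInv y) = y := by
  have hc : Continuous erfc' := continuous_const.sub continuous_erf'
  have ht : Filter.Tendsto erfc' Filter.atTop (nhds 0) := by
    rw [← sub_self (1 : ℝ)]
    exact tendsto_erf'_atTop.const_sub 1
  obtain ⟨b, hb, hb1⟩ := ((ht.eventually_lt_const hy).and (Filter.eventually_ge_atTop 1)).exists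
  obtain ⟨x, hx, hxy⟩ := intermediate_value_Icc' hb1 hc.continuousOn ⟨hb.le, hy'⟩
  have h : ∃ a ∈ Ici (0 : ℝ), erfc' a = y := ⟨x, zero_le_one.trans hx.1, hxy⟩
  exact ⟨invFunOn_mem h, invFunOn_eq h⟩

/-- The smoothed indicator of `[-3b, 3b]` shared by the spatial and the frequency cutoffs. -/
def erfWindow (b t : ℝ) : ℝ := (1/2) * (erf' (t + 3 * b) - erf' (t - 3 * b))

lemma continuous_erfWindow (b : ℝ) : Continuous (erfWindow b) := by
  have := continuous_erf'
  unfold erfWindow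
  fun_prop

lemma erfWindow_nonneg {b : ℝ} (hb : 0 ≤ b) (t : ℝ) : 0 ≤ erfWindow b t := by
  have := monotone_erf' (show t - 3 * b ≤ t + 3 * b by linarith)
  unfold erfWindow
  linarith

lemma erfWindow_le_one (b t : ℝ) : erfWindow b t ≤ 1 := by
  have := erf'_le_one (t + 3 * b)
  have := neg_one_le_erf' (t - 3 * b)
  unfold erfWindow
  linarith

lemma one_sub_erfWindow_le {z b t : ℝ} (hz : z ≤ b) (ht : |t| ≤ 2 * b) :
    1 - erfWindow b t ≤ erfc' z := by
  obtain ⟨h1, h2⟩ := abs_le.1 ht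
  have h3 := monotone_erf' (show z ≤ t + 3 * b by linarith)
  have h4 := monotone_erf' (show z ≤ -(t - 3 * b) by linarith)
  rw [erf'_neg] at h4
  unfold erfWindow erfc'
  linarith

lemma erfWindow_le {z b t : ℝ} (hz : z ≤ b) (ht : 4 * b ≤ |t|) :
    erfWindow b t ≤ erfc' z := by
  have h1 := erf'_le_one (t + 3 * b)
  have h2 := neg_one_le_erf' (t - 3 * b)
  have h5 := erf'_le_one z
  unfold erfWindow erfc'
  rcases le_abs'.1 ht with h | h
  · have h4 := monotone_erf' (show z ≤ -(t + 3 * b) by linarith)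
    rw [erf'_neg] at h4
    linarith
  · have h4 := monotone_erf' (show z ≤ t - 3 * b by linarith)
    linarith

lemma erfWindow_mul_one_sub_erfWindow_le {z b s t : ℝ} (hz : z ≤ b) (hb : 0 ≤ b)
    (hst : 2 * |t| ≤ |s|) : erfWindow b s * (1 - erfWindow b t) ≤ erfc' z := by
  have hs0 := erfWindow_nonneg hb s
  have hs1 := erfWindow_le_one b s
  have ht0 := erfWindow_nonneg hb t
  have ht1 := erfWindow_le_one b t
  rcases le_total |t| (2 * b) with h | h
  · nlinarith [one_sub_erfWindow_le hz h]
  · nlinarith [erfWindow_le hz (show 4 * b ≤ |s| by linarith)]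

lemma chiSc_eq_erfWindow (L σ : ℝ) (m : ℕ) (x : ℝ) :
    chiSc L σ m x = erfWindow (L / (4 * σ)) (x / 2 ^ m / σ) := by
  unfold chiSc chi0 erfWindow
  congr 4 <;> ring

lemma PSc_eq_erfWindow (kmax σ : ℝ) (m : ℕ) (k : ℝ) :
    PSc kmax σ m k = erfWindow (σ * kmax / 8) (σ * (2 ^ m * k)) := by
  unfold PSc P0fun erfWindow
  congr 4 <;> ring

lemma hasTemperateGrowth_exp_neg_sq :
    Function.HasTemperateGrowth fun x : ℝ => Real.exp (-x ^ 2) := by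
  have hd : ∀ n, ∀ x ∈ Iic (0 : ℝ), ‖iteratedFDerivWithin ℝ n Real.exp (Iic 0) x‖ ≤ 1 := by
    intro n x hx
    rw [norm_iteratedFDerivWithin_eq_norm_iteratedDerivWithin,
      iteratedDerivWithin_eq_iteratedDeriv (uniqueDiffOn_Iic 0) Real.contDiff_exp.contDiffAt hx,
      iteratedDeriv_eq_iterate, Real.iter_deriv_exp, Real.norm_of_nonneg (Real.exp_pos x).le]
    exact Real.exp_le_one_iff.2 hx
  refine Function.HasTemperateGrowth.comp' (g := Real.exp) (f := fun x : ℝ => -x ^ 2)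
    (t := Iic 0) ?_ (uniqueDiffOn_Iic 0) Real.contDiff_exp.contDiffOn
    (fun N => ⟨0, 1, zero_le_one, fun n _ x hx => by simpa using hd n x hx⟩) (by fun_prop)
  rintro _ ⟨x, rfl⟩
  exact neg_nonpos.2 (sq_nonneg x)

lemma hasTemperateGrowth_erf' : Function.HasTemperateGrowth erf' := by
  have hd : fderiv ℝ erf' = fun x => (2 / Real.sqrt Real.pi * Real.exp (-x ^ 2)) •
      (1 : ℝ →L[ℝ] ℝ) := by
    ext x
    simp [(hasDerivAt_erf' x).hasFDerivAt.fderiv]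
  refine .of_fderiv (k := 0) (C := 1) ?_ (fun x => (hasDerivAt_erf' x).differentiableAt) ?_
  · rw [hd]
    have := hasTemperateGrowth_exp_neg_sq
    fun_prop
  · intro x
    simpa using abs_le.2 ⟨neg_one_le_erf' x, erf'_le_one x⟩

lemma hasTemperateGrowth_erfWindow (b : ℝ) : Function.HasTemperateGrowth (erfWindow b) := by
  have h := hasTemperateGrowth_erf'
  have h1 : Function.HasTemperateGrowth fun t : ℝ => erf' (t + 3 * b) :=
    h.comp (f := fun t : ℝ => t + 3 * b) (by fun_prop)
  have h2 : Function.HasTemperateGrowth fun t : ℝ => erf' (t - 3 * b) :=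
    h.comp (f := fun t : ℝ => t - 3 * b) (by fun_prop)
  unfold erfWindow
  fun_prop

/-- `T` becomes multiplication by the real function `c` after conjugation with `U`. -/
def IsDiagonalizedBy (U : L2 ≃ₗᵢ[ℂ] L2) (c : ℝ → ℝ) (T : L2 →L[ℂ] L2) : Prop :=
  ∀ f : L2, (U (T f) : ℝ → ℂ) =ᵐ[volume] fun x => (c x : ℂ) * U f x

namespace IsDiagonalizedBy

variable {U : L2 ≃ₗᵢ[ℂ] L2} {c d : ℝ → ℝ} {S T : L2 →L[ℂ] L2}

lemma norm_apply_le (hT : IsDiagonalizedBy U c T) {C : ℝ} (hc : ∀ x, |c x| ≤ C) (f : L2) :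
    ‖T f‖ ≤ C * ‖f‖ := by
  rw [← U.norm_map, ← U.norm_map f]
  refine Lp.norm_le_mul_norm_of_ae_le_mul ?_
  filter_upwards [hT f] with x hx
  rw [hx, norm_mul, Complex.norm_real, Real.norm_eq_abs]
  gcongr
  exact hc x

lemma one_sub (hT : IsDiagonalizedBy U c T) : IsDiagonalizedBy U (fun x => 1 - c x) (1 - T) := by
  intro f
  have h : U ((1 - T) f) = U f - U (T f) := by simp
  rw [h]
  filter_upwards [hT f, Lp.coeFn_sub (U f) (U (T f))] with x h1 h2
  rw [h2, Pi.sub_apply, h1]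
  push_cast
  ring

lemma one_sub_sub (hT : IsDiagonalizedBy U c T) :
    IsDiagonalizedBy U (fun x => 1 - 2 * c x) (1 - T - T) := by
  intro f
  have h : U ((1 - T - T) f) = U ((1 - T) f) - U (T f) := by simp
  rw [h]
  filter_upwards [hT f, hT.one_sub f, Lp.coeFn_sub (U ((1 - T) f)) (U (T f))] with x h1 h2 h3
  rw [h3, Pi.sub_apply, h1, h2]
  push_cast
  ring

lemma comp (hT : IsDiagonalizedBy U c T) (hS : IsDiagonalizedBy U d S) :
    IsDiagonalizedBy U (fun x => c x * d x) (T.comp S) := by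
  intro f
  filter_upwards [hT (S f), hS f] with x h1 h2
  rw [ContinuousLinearMap.comp_apply, h1, h2]
  push_cast
  ring

lemma apply_comm (hT : IsDiagonalizedBy U c T) (hS : IsDiagonalizedBy U d S) (f : L2) :
    T (S f) = S (T f) := by
  refine U.injective (Lp.ext ?_)
  filter_upwards [hT.comp hS f, hS.comp hT f] with x h1 h2
  simp only [ContinuousLinearMap.comp_apply] at h1 h2
  rw [h1, h2, mul_comm (c x)]

lemma inner_apply_left (hT : IsDiagonalizedBy U c T) (f g : L2) :
    inner ℂ (T f) g = inner ℂ f (T g) := by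
  rw [← U.inner_map_map, ← U.inner_map_map f, L2.inner_def, L2.inner_def]
  refine integral_congr_ae ?_
  filter_upwards [hT f, hT g] with x h1 h2
  rw [h1, h2]
  simp only [RCLike.inner_apply, map_mul, Complex.conj_ofReal]
  ring

lemma norm_sq_apply_le_re_inner (hT : IsDiagonalizedBy U c T) (h0 : ∀ x, 0 ≤ c x)
    (h1 : ∀ x, c x ≤ 1) (f : L2) : ‖T f‖ ^ 2 ≤ (inner ℂ f (T f)).re := by
  have h := hT.one_sub_sub.norm_apply_le (C := 1)
    (fun x => abs_le.2 ⟨by linarith [h1 x], by linarith [h0 x]⟩) f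
  have he : (1 - T - T) f = f - (2 : ℂ) • T f := by
    simp [two_smul, sub_sub]
  rw [he, one_mul] at h
  have hs := pow_le_pow_left₀ (norm_nonneg _) h 2
  rw [norm_sub_sq (𝕜 := ℂ), inner_smul_right, norm_smul] at hs
  simp at hs
  nlinarith

end IsDiagonalizedBy

lemma norm_sub_comp_comp_le {U V : L2 ≃ₗᵢ[ℂ] L2} {c d : ℝ → ℝ} {X R : L2 →L[ℂ] L2}
    (hX : IsDiagonalizedBy U c X) (hR : IsDiagonalizedBy V d R)
    (hc : ∀ x, |c x| ≤ 1) (hd0 : ∀ x, 0 ≤ d x) (hd1 : ∀ x, d x ≤ 1) (f : L2) :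
    ‖f - X (R (X f))‖ ≤ ‖f‖ := by
  have h1 := hR.norm_sq_apply_le_re_inner hd0 hd1 (X f)
  have h2 : ‖X (R (X f))‖ ≤ ‖R (X f)‖ := by simpa using hX.norm_apply_le hc (R (X f))
  rw [hX.inner_apply_left] at h1
  refine (sq_le_sq₀ (norm_nonneg _) (norm_nonneg _)).1 ?_
  rw [norm_sub_sq (𝕜 := ℂ)]
  have h3 := pow_le_pow_left₀ (norm_nonneg _) h2 2
  change ‖f‖ ^ 2 - 2 * (inner ℂ f (X (R (X f)))).re + ‖X (R (X f))‖ ^ 2 ≤ ‖f‖ ^ 2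
  nlinarith [sq_nonneg ‖R (X f)‖]

lemma IsMulBy.isDiagonalizedBy {c : ℝ → ℝ} {T : L2 →L[ℂ] L2} (hT : IsMulBy c T) :
    IsDiagonalizedBy (LinearIsometryEquiv.refl ℂ L2) c T := hT

lemma exists_isMulBy {c : ℝ → ℝ} (hc : Continuous c) {C : ℝ} (hC : ∀ x, |c x| ≤ C) :
    ∃ M : L2 →L[ℂ] L2, IsMulBy c M := by
  have hm : MemLp (fun x => (c x : ℂ)) ∞ volume :=
    memLp_top_of_bound (by fun_prop) C (ae_of_all _ fun x => by simpa using hC x)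
  refine ⟨(ContinuousLinearMap.mul ℂ ℂ).holderL volume ∞ 2 2 (hm.toLp _), fun f => ?_⟩
  filter_upwards [(ContinuousLinearMap.mul ℂ ℂ).coeFn_holder (r := 2) (hm.toLp _) f,
    hm.coeFn_toLp] with x h1 h2
  simp only [ContinuousLinearMap.holderL_apply_apply]
  rw [h1, h2, ContinuousLinearMap.mul_apply']

open FourierTransform in
lemma ft_eq_fourier (f : ℝ → ℂ) (k : ℝ) :
    ft f k = (Real.sqrt (2 * Real.pi) : ℂ)⁻¹ * 𝓕 f (k / (2 * Real.pi)) := by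
  rw [ft, Real.fourier_real_eq_integral_exp_smul]
  congr 2
  ext x
  rw [smul_eq_mul]
  congr 2
  push_cast
  have : (Real.pi : ℂ) ≠ 0 := by exact_mod_cast Real.pi_ne_zero
  field_simp

open FourierTransform in
lemma ift_mul_ft_eq_fourierInv (m : ℝ → ℝ) (f : ℝ → ℂ) (x : ℝ) :
    ift (fun k => (m k : ℂ) * ft f k) x =
      𝓕⁻ (fun ξ : ℝ => (m (2 * Real.pi * ξ) : ℂ) * 𝓕 f ξ) x := by
  have hpi : (0 : ℝ) < 2 * Real.pi := by positivity
  have h2 : (Real.sqrt (2 * Real.pi) : ℂ)⁻¹ * (Real.sqrt (2 * Real.pi) : ℂ)⁻¹ *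
      (2 * Real.pi : ℝ) = 1 := by
    have h : ((Real.sqrt (2 * Real.pi) : ℝ) : ℂ) ≠ 0 := by
      exact_mod_cast (Real.sqrt_pos.2 hpi).ne'
    field_simp
    exact_mod_cast (Real.sq_sqrt hpi.le).symm
  let G : ℝ → ℂ := fun ξ =>
    Complex.exp (2 * Real.pi * ξ * x * Complex.I) * ((m (2 * Real.pi * ξ) : ℂ) * 𝓕 f ξ)
  have hG : ∫ k : ℝ, G (k / (2 * Real.pi)) = (2 * Real.pi : ℝ) * ∫ ξ, G ξ := by
    rw [Measure.integral_comp_div G, abs_of_pos hpi, Complex.real_smul]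
  have hi : ∫ k : ℝ, Complex.exp (Complex.I * k * x) * ((m k : ℂ) * ft f k) =
      (Real.sqrt (2 * Real.pi) : ℂ)⁻¹ * ∫ k : ℝ, G (k / (2 * Real.pi)) := by
    rw [← integral_const_mul]
    congr 1
    ext k
    have hk : 2 * Real.pi * (k / (2 * Real.pi)) = k := by field_simp
    have hk' : (2 * Real.pi * ((k / (2 * Real.pi) : ℝ) : ℂ)) = k := by exact_mod_cast hk
    simp only [G, hk, hk', ft_eq_fourier]
    rw [show Complex.I * (k : ℂ) * x = k * x * Complex.I by ring]
    ring
  rw [ift, hi, hG, Real.fourierInv_eq']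
  rw [← mul_assoc, ← mul_assoc, h2, one_mul]
  congr 1
  ext ξ
  simp only [G, smul_eq_mul]
  congr 2
  simp
  ring

open FourierTransform SchwartzMap in
/-- A multiplier operator with bounded symbol of temperate growth is diagonalized by Mathlib's
Fourier transform, the symbol being rescaled to its normalization. -/
lemma IsMultOp.isDiagonalizedBy {m : ℝ → ℝ} {T : L2 →L[ℂ] L2} (hT : IsMultOp m T)
    (hm : Function.HasTemperateGrowth m) {C : ℝ} (hC : ∀ x, |m x| ≤ C) :
    IsDiagonalizedBy (Lp.fourierTransformₗᵢ ℝ ℂ) (fun ξ => m (2 * Real.pi * ξ)) T := by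
  have hg : Function.HasTemperateGrowth fun ξ : ℝ => m (2 * Real.pi * ξ) :=
    hm.comp (f := fun ξ : ℝ => 2 * Real.pi * ξ) (by fun_prop)
  have hg' : Function.HasTemperateGrowth fun ξ : ℝ => (m (2 * Real.pi * ξ) : ℂ) :=
    Function.HasTemperateGrowth.comp (g := Complex.ofReal) (by fun_prop) hg
  obtain ⟨M, hM⟩ := exists_isMulBy hg.1.continuous fun ξ => hC (2 * Real.pi * ξ)
  suffices h : ∀ f : L2, Lp.fourierTransformₗᵢ ℝ ℂ (T f) = M (Lp.fourierTransformₗᵢ ℝ ℂ f) by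
    intro f
    rw [h f]
    exact hM _
  intro f
  refine (SchwartzMap.denseRange_toLpCLM (E := ℝ) (F := ℂ) (p := 2) (μ := volume)
    ENNReal.ofNat_ne_top).induction_on
    (p := fun f : L2 => Lp.fourierTransformₗᵢ ℝ ℂ (T f) = M (Lp.fourierTransformₗᵢ ℝ ℂ f))
    f (isClosed_eq (by fun_prop) (by fun_prop)) fun φ => ?_
  change 𝓕 (T (φ.toLp 2)) = M (𝓕 (φ.toLp 2))
  set f : L2 := φ.toLp 2 with hf
  have hae : (f : ℝ → ℂ) =ᵐ[volume] φ := φ.coeFn_toLp 2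
  have hF : 𝓕 (f : ℝ → ℂ) = 𝓕 φ := by
    rw [fourier_coe]
    ext ξ
    simp only [Real.fourier_eq]
    refine integral_congr_ae ?_
    filter_upwards [hae] with x hx
    rw [hx]
  have hft : ft (f : ℝ → ℂ) = fun k =>
      (Real.sqrt (2 * Real.pi) : ℂ)⁻¹ * 𝓕 φ (k / (2 * Real.pi)) := by
    ext k
    rw [ft_eq_fourier, hF]
  have hint : Integrable (ft (f : ℝ → ℂ)) := by
    rw [hft]
    exact ((𝓕 φ).integrable.comp_div (by positivity)).const_mul _
  have hTf := hT f (φ.integrable.congr hae.symm) hint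
  set ψ : 𝓢(ℝ, ℂ) := smulLeftCLM ℂ (fun ξ : ℝ => (m (2 * Real.pi * ξ) : ℂ)) (𝓕 φ) with hψ
  have hψ_apply : ∀ ξ, ψ ξ = (m (2 * Real.pi * ξ) : ℂ) * 𝓕 φ ξ := fun ξ => by
    rw [hψ, smulLeftCLM_apply_apply hg', smul_eq_mul]
  have hTψ : T f = (𝓕⁻ ψ).toLp 2 := by
    refine Lp.ext ?_
    filter_upwards [hTf, (𝓕⁻ ψ).coeFn_toLp 2] with x h1 h2
    rw [h1, h2, ift_mul_ft_eq_fourierInv, hF, fourierInv_coe]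
    exact congrArg (fun g : ℝ → ℂ => 𝓕⁻ g x) (funext fun ξ => (hψ_apply ξ).symm)
  rw [hTψ, toLp_fourier_eq, fourier_fourierInv_eq, hf, toLp_fourier_eq]
  refine Lp.ext ?_
  filter_upwards [ψ.coeFn_toLp 2, hM ((𝓕 φ).toLp 2), (𝓕 φ).coeFn_toLp 2] with ξ h1 h2 h3
  rw [h1, h2, h3, hψ_apply]

section Recursion

variable {H : Type*} [NormedAddCommGroup H] [NormedSpace ℂ H]

lemma norm_one_sub_prod_le {P Q : ℕ → H →L[ℂ] H} {δ : ℝ} (hQ0 : Q 0 = P 0)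
    (hQS : ∀ m, Q (m+1) = (P (m+1)).comp (Q m))
    (hP : ∀ n u, ‖P n u‖ ≤ ‖u‖) (hcomm : ∀ i j u, P i (P j u) = P j (P i u))
    (hPP : ∀ j n, j < n → ∀ u, ‖P n ((1 - P j) u)‖ ≤ δ * ‖u‖) (n j : ℕ) (hj : j < n) (u : H) :
    ‖P n ((1 - Q j) u)‖ ≤ (j + 1) * δ * ‖u‖ := by
  induction j with
  | zero => simpa [hQ0] using hPP 0 n hj u
  | succ j ih =>
    have h : P n ((1 - Q (j + 1)) u) =
        P n ((1 - P (j + 1)) u) + P (j + 1) (P n ((1 - Q j) u)) := by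
      rw [hcomm (j + 1) n, ← map_add]
      simp [hQS]
    rw [h]
    calc _ ≤ ‖P n ((1 - P (j + 1)) u)‖ + ‖P n ((1 - Q j) u)‖ :=
          (norm_add_le _ _).trans (by gcongr; exact hP _ _)
      _ ≤ δ * ‖u‖ + (j + 1) * δ * ‖u‖ := add_le_add (hPP _ _ hj u) (ih (by lia))
      _ = _ := by push_cast; ring

/-- Inserting the cutoffs `X'` around `1 - P'` barely changes its action on the range of a
finer-scale localization `a = X v` that is nearly annihilated by `P'`. -/
lemma norm_one_sub_sub_comp_le {X' P' : H →L[ℂ] H} {a : H} {ε η : ℝ}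
    (hX1 : ∀ u, ‖X' u‖ ≤ ‖u‖) (hX2 : ∀ u, ‖(1 - X') u‖ ≤ ‖u‖)
    (hP2 : ∀ u, ‖(1 - P') u‖ ≤ ‖u‖) (ha : ‖(1 - X') a‖ ≤ ε) (hPa : ‖P' a‖ ≤ η) :
    ‖(1 - P') a - X' ((1 - P') (X' a))‖ ≤ 2 * ε + η := by
  have h : (1 - P') a - X' ((1 - P') (X' a)) =
      (1 - X') a - (1 - X') (P' a) + X' ((1 - P') ((1 - X') a)) := by
    simp only [sub_apply, one_apply_eq_self, map_sub]
    abel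
  rw [h]
  have h1 := hX2 (P' a)
  have h2 := (hX1 ((1 - P') ((1 - X') a))).trans (hP2 _)
  have h3 := norm_add_le ((1 - X') a - (1 - X') (P' a)) (X' ((1 - P') ((1 - X') a)))
  have h4 := norm_sub_le ((1 - X') a) ((1 - X') (P' a))
  linarith

lemma norm_recursion_sub_prod_le {X P Q : ℕ → H →L[ℂ] H} {δ : ℝ} (hδ : 0 ≤ δ)
    (hX : ∀ n u, ‖X n u‖ ≤ ‖u‖) (hX' : ∀ n u, ‖(1 - X n) u‖ ≤ ‖u‖)
    (hP : ∀ n u, ‖P n u‖ ≤ ‖u‖) (hP' : ∀ n u, ‖(1 - P n) u‖ ≤ ‖u‖)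
    (hcomm : ∀ i j u, P i (P j u) = P j (P i u))
    (hXX : ∀ n u, ‖(1 - X (n + 1)) (X n u)‖ ≤ δ * ‖u‖)
    (hPP : ∀ j n, j < n → ∀ u, ‖P n ((1 - P j) u)‖ ≤ δ * ‖u‖)
    (hA : ∀ n u, ‖u - X n ((1 - P n) (X n u))‖ ≤ ‖u‖)
    {f : H} (hloc : ∀ n, ‖(1 - P n) f - X n ((1 - P n) (X n f))‖ ≤ δ * ‖f‖)
    {g : ℕ → H} (hg0 : g 0 = f - X 0 ((1 - P 0) (X 0 f)))
    (hgS : ∀ n, g (n + 1) = g n - X (n + 1) ((1 - P (n + 1)) (X (n + 1) (g n))))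
    (hQ0 : Q 0 = P 0) (hQS : ∀ m, Q (m+1) = (P (m+1)).comp (Q m)) (m : ℕ) :
    ‖g m - Q m f‖ ≤ δ * ((m:ℝ) ^ 2 + 6 * m + 1) * ‖f‖ := by
  induction m with
  | zero =>
    have h : g 0 - Q 0 f = (1 - P 0) f - X 0 ((1 - P 0) (X 0 f)) := by
      rw [hg0, hQ0]
      simp only [sub_apply, one_apply_eq_self]
      abel
    rw [h]
    simpa using hloc 0
  | succ m ih =>
    set X' := X (m + 1) with hX'_def
    set P' := P (m + 1) with hP'_def
    let B : H →L[ℂ] H := (1 - P') - X'.comp ((1 - P').comp X')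
    have hB_apply : ∀ u, B u = (1 - P') u - X' ((1 - P') (X' u)) := fun u => rfl
    have hB : ∀ u, ‖B u‖ ≤ 2 * ‖u‖ := fun u => by
      have h1 := hP' (m + 1) u
      have h2 := (hX (m + 1) ((1 - P') (X' u))).trans ((hP' (m + 1) _).trans (hX (m + 1) u))
      have h3 := norm_sub_le ((1 - P') u) (X' ((1 - P') (X' u)))
      rw [hB_apply]
      linarith
    set a := X m ((1 - P m) (X m f)) with ha_def
    have ha : ‖(1 - X') a‖ ≤ δ * ‖f‖ := (hXX m _).trans <| by
      gcongr
      exact (hP' m _).trans (hX m f)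
    have hPa : ‖P' a‖ ≤ 2 * δ * ‖f‖ := by
      have h1 := hPP m (m + 1) m.lt_succ_self f
      have h2 := (hP (m + 1) ((1 - P m) f - a)).trans (hloc m)
      have h3 := norm_sub_le (P' ((1 - P m) f)) (P' ((1 - P m) f - a))
      rw [← map_sub, sub_sub_cancel] at h3
      linarith
    have hBa : ‖B a‖ ≤ 4 * δ * ‖f‖ := by
      have := norm_one_sub_sub_comp_le (hX (m + 1)) (hX' (m + 1)) (hP' (m + 1)) ha hPa
      rw [hB_apply]
      linarith
    have hr : ‖f - a - Q m f‖ ≤ (m + 1) * δ * ‖f‖ := by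
      cases m with
      | zero =>
        have h : f - a - Q 0 f = (1 - P 0) f - a := by
          rw [hQ0]
          simp only [sub_apply, one_apply_eq_self]
          abel
        rw [h]
        simpa only [Nat.cast_zero, zero_add, one_mul] using hloc 0
      | succ k =>
        have h : f - a - Q (k + 1) f = ((1 - P (k + 1)) f - a) + P (k + 1) ((1 - Q k) f) := by
          rw [hQS]
          simp only [sub_apply, one_apply_eq_self,
            ContinuousLinearMap.comp_apply, map_sub]
          abel
        rw [h]
        have h1 := hloc (k + 1)
        have h2 := norm_one_sub_prod_le hQ0 hQS hP hcomm hPP (k + 1) k k.lt_succ_self f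
        refine (norm_add_le _ _).trans ((add_le_add h1 h2).trans_eq ?_)
        push_cast
        ring
    have hBQ : ‖B (Q m f)‖ ≤ (2 * m + 7) * δ * ‖f‖ := by
      have h : B (Q m f) = B f - B a - B (f - a - Q m f) := by
        simp only [map_sub]
        abel
      rw [h]
      have h1 : ‖B f‖ ≤ δ * ‖f‖ := hloc (m + 1)
      have h2 := hB (f - a - Q m f)
      have h3 := norm_sub_le (B f - B a) (B (f - a - Q m f))
      have h4 := norm_sub_le (B f) (B a)
      linarith
    have h : g (m + 1) - Q (m + 1) f = ((g m - Q m f) -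
        X' ((1 - P') (X' (g m - Q m f)))) + B (Q m f) := by
      rw [hgS, hQS, hB_apply]
      simp only [sub_apply, one_apply_eq_self,
        ContinuousLinearMap.comp_apply, map_sub]
      abel
    rw [h]
    have h1 := hA (m + 1) (g m - Q m f)
    refine (norm_add_le _ _).trans ((add_le_add (h1.trans ih) hBQ).trans_eq ?_)
    push_cast
    ring

end Recursion

/-- ‖f⁻ₘ − Pₘ⋯P₀ f‖ ≤ δ₁((3m²+15m)/2 + 6 + 75 kmax)‖f‖. -/
theorem stmt3 (L kmax σ δ₁ : ℝ) (hL : 0 < L) (hk : 0 < kmax) (hσ : 0 < σ)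
    (hδpos : 0 < δ₁) (hδle : δ₁ ≤ erfc' 1)
    (hσlo : 8 * erfcInv δ₁ / kmax ≤ σ) (hσhi : σ ≤ L / (8 * erfcInv δ₁))
    (X P : ℕ → (L2 →L[ℂ] L2))
    (hX : ∀ m, IsMulBy (chiSc L σ m) (X m)) (hP : ∀ m, IsMultOp (PSc kmax σ m) (P m))
    (f : L2)
    -- f is phase-space localized with tolerance δ₁:
    (hloc : ∀ m, ‖(1 - P m) f - X m ((1 - P m) (X m f))‖ ≤ δ₁ * ‖f‖)
    -- the recursive multiscale decomposition f⁺ₘ, f⁻ₘ: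
    (fp fm : ℕ → L2)
    (hfp0 : fp 0 = X 0 ((1 - P 0) (X 0 f)))
    (hfm0 : fm 0 = f - fp 0)
    (hfpS : ∀ m, fp (m+1) = X (m+1) ((1 - P (m+1)) (X (m+1) (fm m))))
    (hfmS : ∀ m, fm (m+1) = fm m - fp (m+1))
    -- Q m = Pₘ ∘ Pₘ₋₁ ∘ ⋯ ∘ P₁ ∘ P₀:
    (Q : ℕ → (L2 →L[ℂ] L2))
    (hQ0 : Q 0 = P 0)
    (hQS : ∀ m, Q (m+1) = (P (m+1)).comp (Q m))
    (m : ℕ) :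
    ‖fm m - Q m f‖ ≤ δ₁ * ((3*(m:ℝ)^2 + 15*(m:ℝ))/2 + 6 + 75*kmax) * ‖f‖ := by
  obtain ⟨hz0, hz⟩ := erfcInv_nonneg_and_erfc'_erfcInv hδpos hδle
  set z := erfcInv δ₁
  have hzpos : 0 < z := by
    rcases hz0.eq_or_lt with h | h
    · rw [← h] at hσhi
      simp at hσhi
      linarith
    · exact h
  have hbP : z ≤ σ * kmax / 8 := by
    rw [div_le_iff₀ hk] at hσlo
    linarith
  have hbX : z ≤ L / (4 * σ) := by
    rw [le_div_iff₀ (by positivity)] at hσhi ⊢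
    nlinarith
  have hbP0 := hz0.trans hbP
  have hbX0 := hz0.trans hbX
  have hXd := fun n => (hX n).isDiagonalizedBy
  have hχ0 : ∀ n x, 0 ≤ chiSc L σ n x := fun n x => by
    rw [chiSc_eq_erfWindow]; exact erfWindow_nonneg hbX0 _
  have hχ1 : ∀ n x, chiSc L σ n x ≤ 1 := fun n x => by
    rw [chiSc_eq_erfWindow]; exact erfWindow_le_one _ _
  have hp0 : ∀ n k, 0 ≤ PSc kmax σ n k := fun n k => by
    rw [PSc_eq_erfWindow]; exact erfWindow_nonneg hbP0 _
  have hp1 : ∀ n k, PSc kmax σ n k ≤ 1 := fun n k => by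
    rw [PSc_eq_erfWindow]; exact erfWindow_le_one _ _
  have abs_le_one : ∀ {t : ℝ}, 0 ≤ t → t ≤ 1 → |t| ≤ 1 := fun h0 h1 => abs_le.2 ⟨by linarith, h1⟩
  have abs_one_sub_le_one : ∀ {t : ℝ}, 0 ≤ t → t ≤ 1 → |1 - t| ≤ 1 := fun h0 h1 =>
    abs_le.2 ⟨by linarith, by linarith⟩
  have hPg : ∀ n, Function.HasTemperateGrowth (PSc kmax σ n) := fun n => by
    rw [funext (PSc_eq_erfWindow kmax σ n)]
    exact (hasTemperateGrowth_erfWindow _).comp (f := fun k : ℝ => σ * (2 ^ n * k)) (by fun_prop)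
  have hPd := fun n => (hP n).isDiagonalizedBy (hPg n) fun k => abs_le_one (hp0 n k) (hp1 n k)
  have hχχ : ∀ n x, |(1 - chiSc L σ (n + 1) x) * chiSc L σ n x| ≤ δ₁ := fun n x => by
    rw [abs_of_nonneg (mul_nonneg (sub_nonneg.2 (hχ1 _ _)) (hχ0 _ _)), mul_comm, ← hz,
      chiSc_eq_erfWindow, chiSc_eq_erfWindow]
    refine erfWindow_mul_one_sub_erfWindow_le hbX hbX0 (le_of_eq ?_)
    rw [← abs_two, ← abs_mul, abs_two]
    congr 1
    field_simp
    ring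
  have hpp : ∀ j n, j < n → ∀ k, |PSc kmax σ n k * (1 - PSc kmax σ j k)| ≤ δ₁ := fun j n hjn k => by
    rw [abs_of_nonneg (mul_nonneg (hp0 _ _) (sub_nonneg.2 (hp1 _ _))), ← hz,
      PSc_eq_erfWindow, PSc_eq_erfWindow]
    refine erfWindow_mul_one_sub_erfWindow_le hbP hbP0 ?_
    have h2 : (2 : ℝ) * 2 ^ j ≤ 2 ^ n := by
      rw [← pow_succ']
      exact pow_le_pow_right₀ one_le_two hjn
    simp only [abs_mul, abs_pow, abs_two, abs_of_pos hσ]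
    nlinarith [mul_le_mul_of_nonneg_right h2 (mul_nonneg hσ.le (abs_nonneg k))]
  have key := norm_recursion_sub_prod_le (X := X) (P := P) (g := fm) hδpos.le
    (fun n u => by simpa using (hXd n).norm_apply_le (fun x => abs_le_one (hχ0 n x) (hχ1 n x)) u)
    (fun n u => by
      simpa using (hXd n).one_sub.norm_apply_le
        (fun x => abs_one_sub_le_one (hχ0 n x) (hχ1 n x)) u)
    (fun n u => by simpa using (hPd n).norm_apply_le (fun x => abs_le_one (hp0 n _) (hp1 n _)) u)
    (fun n u => by
      simpa using (hPd n).one_sub.norm_apply_le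
        (fun x => abs_one_sub_le_one (hp0 n _) (hp1 n _)) u)
    (fun i j => (hPd i).apply_comm (hPd j))
    (fun n u => ((hXd (n + 1)).one_sub.comp (hXd n)).norm_apply_le (hχχ n) u)
    (fun j n hjn u => ((hPd n).comp (hPd j).one_sub).norm_apply_le (fun x => hpp j n hjn _) u)
    (fun n u => norm_sub_comp_comp_le (hXd n) (hPd n).one_sub
      (fun x => abs_le_one (hχ0 n x) (hχ1 n x)) (fun x => sub_nonneg.2 (hp1 n _))
      (fun x => sub_le_self _ (hp0 n _)) u)
    hloc (by rw [hfm0, hfp0]) (fun n => by rw [hfmS, hfpS]) hQ0 hQS m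
  have hm : (m : ℝ) ^ 2 + 6 * m + 1 ≤ (3 * (m : ℝ) ^ 2 + 15 * m) / 2 + 6 + 75 * kmax := by
    nlinarith [sq_nonneg (m : ℝ), (Nat.cast_nonneg m : (0 : ℝ) ≤ m)]
  exact key.trans (by gcongr)

end
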